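/- Let R > 0 and suppose ‖m‖ ≤ R/2. Then for every x ∈ ℝ^d with ‖x‖ ≤ R/2 and every 0 < r ≤ 1, |η̄(x,r) − η(x)| ≤ 60 · π · e · d · R² · exp(R²/d) · μ(B(x,r))^(2/d). -/

import Mathlib

open MeasureTheory Real

/-- Standard Gaussian density on `ℝ^d`. -/
noncomputable def stdGaussianDensity (d : ℕ) (x : EuclideanSpace ℝ (Fin d)) : ℝ :=
  (2 * π) ^ (-(d : ℝ) / 2) * Real.exp (-‖x‖ ^ 2 / 2)

/-- Regression function of the Gaussian translation model:
`η(x) = γ_d(x − m) / (γ_d(x) + γ_d(x − m))`. -/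
noncomputable def gaussEta (d : ℕ) (m : EuclideanSpace ℝ (Fin d))
    (x : EuclideanSpace ℝ (Fin d)) : ℝ :=
  stdGaussianDensity d (x - m) / (stdGaussianDensity d x + stdGaussianDensity d (x - m))

/-- Marginal (mixture) law of the design: density `(γ_d(x) + γ_d(x − m))/2`
with respect to Lebesgue measure. -/
noncomputable def gaussMixture (d : ℕ) (m : EuclideanSpace ℝ (Fin d)) :
    Measure (EuclideanSpace ℝ (Fin d)) :=
  volume.withDensity fun x =>
    ENNReal.ofReal ((stdGaussianDensity d x + stdGaussianDensity d (x - m)) / 2)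

/-- `μ`-average of `η` over the Euclidean ball `B(x,r)`. -/
noncomputable def gaussEtaBar (d : ℕ) (m : EuclideanSpace ℝ (Fin d))
    (x : EuclideanSpace ℝ (Fin d)) (r : ℝ) : ℝ :=
  ((gaussMixture d m (Metric.ball x r)).toReal)⁻¹ *
    ∫ y in Metric.ball x r, gaussEta d m y ∂(gaussMixture d m)

section GaussianDensity

variable {d : ℕ}

theorem stdGaussianDensity_pos (x : EuclideanSpace ℝ (Fin d)) : 0 < stdGaussianDensity d x := by
  unfold stdGaussianDensity; positivity

theorem continuous_stdGaussianDensity : Continuous (stdGaussianDensity d) := by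
  unfold stdGaussianDensity; fun_prop

/-- The two values of the Gaussian density at points symmetric about `x` add up to a hyperbolic
cosine. -/
theorem stdGaussianDensity_add_add_sub (x h : EuclideanSpace ℝ (Fin d)) :
    stdGaussianDensity d (x + h) + stdGaussianDensity d (x - h) =
      2 * stdGaussianDensity d x * Real.exp (-‖h‖ ^ 2 / 2) * Real.cosh (inner ℝ x h) := by
  have h1 : Real.exp (-‖x + h‖ ^ 2 / 2) =
      Real.exp (-‖x‖ ^ 2 / 2) * Real.exp (-‖h‖ ^ 2 / 2) * Real.exp (-inner ℝ x h) := by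
    rw [← Real.exp_add, ← Real.exp_add, norm_add_sq_real]; ring_nf
  have h2 : Real.exp (-‖x - h‖ ^ 2 / 2) =
      Real.exp (-‖x‖ ^ 2 / 2) * Real.exp (-‖h‖ ^ 2 / 2) * Real.exp (inner ℝ x h) := by
    rw [← Real.exp_add, ← Real.exp_add, norm_sub_sq_real]; ring_nf
  simp only [stdGaussianDensity, h1, h2, Real.cosh_eq]
  ring

theorem Continuous.integrableOn_ball {f : EuclideanSpace ℝ (Fin d) → ℝ} (hf : Continuous f) (x : EuclideanSpace ℝ (Fin d)) (r : ℝ) :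
    IntegrableOn f (Metric.ball x r) :=
  (hf.continuousOn.integrableOn_compact (isCompact_closedBall x r)).mono_set
    Metric.ball_subset_closedBall

/-- The integral over a ball is nonnegative as soon as the integrand symmetrized about the center
is nonnegative. -/
theorem setIntegral_ball_nonneg_of_add_reflection_nonneg {f : EuclideanSpace ℝ (Fin d) → ℝ} (hf : Continuous f)
    (x : EuclideanSpace ℝ (Fin d)) (r : ℝ) (h : ∀ v : EuclideanSpace ℝ (Fin d), ‖v‖ < r → 0 ≤ f (x + v) + f (x - v)) :
    0 ≤ ∫ y in Metric.ball x r, f y := by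
  have hrefl : ∫ y in Metric.ball x r, f (x + x - y) = ∫ y in Metric.ball x r, f y := by
    rw [← integral_indicator Metric.isOpen_ball.measurableSet,
      ← integral_indicator Metric.isOpen_ball.measurableSet,
      ← integral_sub_left_eq_self ((Metric.ball x r).indicator f) volume (x + x)]
    congr 1 with y
    have hmem : x + x - y ∈ Metric.ball x r ↔ y ∈ Metric.ball x r := by
      rw [mem_ball_iff_norm, mem_ball_iff_norm', show x + x - y - x = x - y by abel]
    by_cases hy : y ∈ Metric.ball x r
    · rw [Set.indicator_of_mem hy, Set.indicator_of_mem (hmem.2 hy)]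
    · rw [Set.indicator_of_notMem hy, Set.indicator_of_notMem (fun h ↦ hy (hmem.1 h))]
  have hsum : 0 ≤ ∫ y in Metric.ball x r, (f y + f (x + x - y)) := by
    refine setIntegral_nonneg Metric.isOpen_ball.measurableSet fun y hy ↦ ?_
    have := h (y - x) (mem_ball_iff_norm.1 hy)
    rwa [add_sub_cancel, show x - (y - x) = x + x - y by abel] at this
  have hf' : Continuous fun y ↦ f (x + x - y) := by fun_prop
  rw [integral_add (hf.integrableOn_ball x r) (hf'.integrableOn_ball x r), hrefl] at hsum
  linarith

theorem Real.cosh_mul_one_sub_le_one {u t : ℝ} (h : u ^ 2 / 2 ≤ t) :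
    Real.cosh u * (1 - t) ≤ 1 := by
  have h1 : 1 - t ≤ Real.exp (-(u ^ 2 / 2)) := by
    linarith [Real.add_one_le_exp (-(u ^ 2 / 2))]
  calc Real.cosh u * (1 - t) ≤ Real.cosh u * Real.exp (-(u ^ 2 / 2)) :=
        mul_le_mul_of_nonneg_left h1 (Real.cosh_pos u).le
    _ ≤ Real.exp (u ^ 2 / 2) * Real.exp (-(u ^ 2 / 2)) :=
        mul_le_mul_of_nonneg_right (Real.cosh_le_exp_half_sq u) (Real.exp_pos _).le
    _ = 1 := by rw [← Real.exp_add]; simp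

theorem mul_div_add_mul_sub_le {a b t c c' : ℝ} (ha : 0 < a) (hb : 0 < b) (ht : 0 ≤ t)
    (hc : 0 ≤ c) (hct : c * (1 - t) ≤ 1) (hc' : 1 ≤ c') :
    a * b / (a + b) * (c - c') ≤ t * (a * c' + b * c) := by
  have h1 : a * b / (a + b) ≤ b := by
    rw [div_le_iff₀ (by positivity)]; nlinarith
  calc a * b / (a + b) * (c - c') ≤ a * b / (a + b) * (t * c) := by
        gcongr; linarith
    _ ≤ b * (t * c) := by gcongr
    _ ≤ t * (a * c' + b * c) := by
        have : 0 ≤ t * (a * c') := by positivity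
        linarith

theorem half_inner_sq_le {u v : EuclideanSpace ℝ (Fin d)} {R r : ℝ} (hu : ‖u‖ ≤ R) (hv : ‖v‖ ≤ r) :
    (inner ℝ u v) ^ 2 / 2 ≤ R ^ 2 * r ^ 2 / 2 := by
  have h : |inner ℝ u v| ≤ R * r :=
    (abs_real_inner_le_norm u v).trans
      (mul_le_mul hu hv (norm_nonneg _) ((norm_nonneg _).trans hu))
  have := sq_le_sq' (abs_le.1 h).1 (abs_le.1 h).2
  rw [mul_pow] at this
  linarith

theorem continuous_gaussMixtureDensity (m : EuclideanSpace ℝ (Fin d)) :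
    Continuous fun y : EuclideanSpace ℝ (Fin d) ↦ (stdGaussianDensity d y + stdGaussianDensity d (y - m)) / 2 := by
  have := continuous_stdGaussianDensity (d := d)
  fun_prop

theorem setIntegral_gaussMixture (m x : EuclideanSpace ℝ (Fin d)) (r : ℝ) (g : EuclideanSpace ℝ (Fin d) → ℝ) :
    ∫ y in Metric.ball x r, g y ∂(gaussMixture d m) =
      ∫ y in Metric.ball x r,
        (stdGaussianDensity d y + stdGaussianDensity d (y - m)) / 2 * g y := by
  rw [gaussMixture, setIntegral_withDensity_eq_setIntegral_toReal_smul
    (continuous_gaussMixtureDensity m).measurable.ennreal_ofReal (by simp) _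
    Metric.isOpen_ball.measurableSet]
  refine integral_congr_ae (.of_forall fun y ↦ ?_)
  have h1 := stdGaussianDensity_pos y
  have h2 := stdGaussianDensity_pos (y - m)
  simp only [smul_eq_mul]
  rw [ENNReal.toReal_ofReal (by positivity)]

theorem gaussMixture_ball_toReal (m x : EuclideanSpace ℝ (Fin d)) (r : ℝ) :
    (gaussMixture d m (Metric.ball x r)).toReal =
      ∫ y in Metric.ball x r, (stdGaussianDensity d y + stdGaussianDensity d (y - m)) / 2 := by
  simpa [Measure.real] using setIntegral_gaussMixture m x r fun _ ↦ 1

theorem setIntegral_gaussEta (m x : EuclideanSpace ℝ (Fin d)) (r : ℝ) :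
    ∫ y in Metric.ball x r, gaussEta d m y ∂(gaussMixture d m) =
      ∫ y in Metric.ball x r, stdGaussianDensity d (y - m) / 2 := by
  rw [setIntegral_gaussMixture]
  refine integral_congr_ae (.of_forall fun y ↦ ?_)
  have h1 := stdGaussianDensity_pos y
  have h2 := stdGaussianDensity_pos (y - m)
  simp only [gaussEta]
  field_simp

/-- The local bias of the regression function is of second order in the radius. -/
theorem abs_setIntegral_gaussEta_sub_le (m x : EuclideanSpace ℝ (Fin d)) {R r : ℝ} (hx : ‖x‖ ≤ R) (hxm : ‖x - m‖ ≤ R) :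
    |∫ y in Metric.ball x r, gaussEta d m y ∂(gaussMixture d m) -
        gaussEta d m x * (gaussMixture d m (Metric.ball x r)).toReal| ≤
      R ^ 2 * r ^ 2 / 2 * (gaussMixture d m (Metric.ball x r)).toReal := by
  rw [setIntegral_gaussEta, gaussMixture_ball_toReal]
  set t := R ^ 2 * r ^ 2 / 2 with ht
  have ht0 : 0 ≤ t := by positivity
  have hp := continuous_gaussMixtureDensity m
  have hq : Continuous fun y : EuclideanSpace ℝ (Fin d) ↦ stdGaussianDensity d (y - m) / 2 := by
    have := continuous_stdGaussianDensity (d := d)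
    fun_prop
  have key (s : ℝ) (hs : s = 1 ∨ s = -1) :
      0 ≤ ∫ y in Metric.ball x r,
        ((t + s * gaussEta d m x) * ((stdGaussianDensity d y + stdGaussianDensity d (y - m)) / 2) -
          s * (stdGaussianDensity d (y - m) / 2)) := by
    refine setIntegral_ball_nonneg_of_add_reflection_nonneg (by fun_prop) x r fun v hv ↦ ?_
    have e1 := stdGaussianDensity_add_add_sub x v
    have e2 := stdGaussianDensity_add_add_sub (x - m) v
    rw [sub_add_eq_add_sub, sub_right_comm] at e2
    have ha := stdGaussianDensity_pos x
    have hb := stdGaussianDensity_pos (x - m)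
    have c1 := Real.cosh_mul_one_sub_le_one (half_inner_sq_le hx hv.le)
    have c2 := Real.cosh_mul_one_sub_le_one (half_inner_sq_le hxm hv.le)
    have o1 := Real.one_le_cosh (inner ℝ x v)
    have o2 := Real.one_le_cosh (inner ℝ (x - m) v)
    have hE := Real.exp_pos (-‖v‖ ^ 2 / 2)
    rw [← ht] at c1 c2
    unfold gaussEta
    generalize stdGaussianDensity d (x + v) = g1 at *
    generalize stdGaussianDensity d (x - v) = g2 at *
    generalize stdGaussianDensity d (x + v - m) = g3 at *
    generalize stdGaussianDensity d (x - v - m) = g4 at *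
    generalize stdGaussianDensity d x = a at *
    generalize stdGaussianDensity d (x - m) = b at *
    generalize Real.cosh (inner ℝ x v) = C₁ at *
    generalize Real.cosh (inner ℝ (x - m) v) = C₂ at *
    generalize Real.exp (-‖v‖ ^ 2 / 2) = e at *
    have b1 := mul_div_add_mul_sub_le ha hb ht0 (by linarith) c2 o1
    have b2 := mul_div_add_mul_sub_le hb ha ht0 (by linarith) c1 o2
    have hsum : (t + s * (b / (a + b))) * ((g1 + g3) / 2) - s * (g3 / 2) +
        ((t + s * (b / (a + b))) * ((g2 + g4) / 2) - s * (g4 / 2)) =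
        e * (t * (a * C₁ + b * C₂) - s * (a * b / (a + b) * (C₂ - C₁))) := by
      have h1 : g1 = 2 * a * e * C₁ - g2 := by linarith
      have h3 : g3 = 2 * b * e * C₂ - g4 := by linarith
      rw [h1, h3]
      field_simp
      ring
    rw [hsum]
    refine mul_nonneg hE.le ?_
    rcases hs with rfl | rfl
    · linarith
    · rw [mul_comm b a, add_comm b a] at b2
      linarith
  have hint (s : ℝ) : ∫ y in Metric.ball x r,
        ((t + s * gaussEta d m x) * ((stdGaussianDensity d y + stdGaussianDensity d (y - m)) / 2) -
          s * (stdGaussianDensity d (y - m) / 2)) =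
      (t + s * gaussEta d m x) *
        (∫ y in Metric.ball x r, (stdGaussianDensity d y + stdGaussianDensity d (y - m)) / 2) -
      s * ∫ y in Metric.ball x r, stdGaussianDensity d (y - m) / 2 := by
    rw [integral_sub ((hp.integrableOn_ball x r).const_mul _)
      ((hq.integrableOn_ball x r).const_mul _), integral_const_mul, integral_const_mul]
  have k1 := key 1 (.inl rfl)
  have k2 := key (-1) (.inr rfl)
  rw [hint] at k1 k2
  rw [abs_le]
  constructor <;> linarith

theorem Real.Gamma_half_add_one_le_sqrt_pow (n : ℕ) :
    Real.Gamma ((n : ℝ) / 2 + 1) ≤ √(n : ℝ) ^ n := by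
  induction n using Nat.twoStepInduction with
  | zero => simp
  | one =>
    have := Real.Gamma_three_div_two_lt_one
    norm_num at *
    exact this.le
  | more n ih _ =>
    have h : ((n + 2 : ℕ) : ℝ) / 2 + 1 = ((n : ℝ) / 2 + 1) + 1 := by push_cast; ring
    rw [h, Real.Gamma_add_one (by positivity), pow_add, Real.sq_sqrt (by positivity), mul_comm]
    refine mul_le_mul (ih.trans ?_) ?_ (by positivity) (by positivity)
    · gcongr; simp
    · push_cast; linarith [n.cast_nonneg (α := ℝ)]

/-- A lower bound for the volume of a Euclidean ball, free of the Gamma function. -/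
theorem EuclideanSpace.pow_le_volume_real_ball (hd : 1 ≤ d) (x : EuclideanSpace ℝ (Fin d)) {r : ℝ} (hr : 0 ≤ r) :
    (r * √π / √(d : ℝ)) ^ d ≤ volume.real (Metric.ball x r) := by
  have : Nonempty (Fin d) := ⟨⟨0, hd⟩⟩
  have hd0 : (0 : ℝ) < d := by exact_mod_cast hd
  have hG : 0 < Real.Gamma ((d : ℝ) / 2 + 1) := Real.Gamma_pos_of_pos (by positivity)
  rw [Measure.real, EuclideanSpace.volume_ball, Fintype.card_fin, ENNReal.toReal_mul,
    ENNReal.toReal_pow, ENNReal.toReal_ofReal hr, ENNReal.toReal_ofReal (by positivity),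
    div_pow, mul_pow, mul_div_assoc]
  gcongr
  exact Real.Gamma_half_add_one_le_sqrt_pow d

theorem le_gaussMixture_ball_toReal (hd : 1 ≤ d) (m x : EuclideanSpace ℝ (Fin d)) {R r : ℝ}
    (hx : ‖x‖ ≤ R / 2) (hr0 : 0 < r) (hr1 : r ≤ 1) :
    Real.exp (-1) / 2 * (Real.exp (-R ^ 2 / (2 * d)) * r / √(2 * d)) ^ d ≤
      (gaussMixture d m (Metric.ball x r)).toReal := by
  have hd0 : (0 : ℝ) < d := by exact_mod_cast hd
  set c := (2 * π) ^ (-(d : ℝ) / 2) * Real.exp (-R ^ 2 / 2 - 1) / 2 with hc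
  have hlow : ∀ y ∈ Metric.ball x r,
      c ≤ (stdGaussianDensity d y + stdGaussianDensity d (y - m)) / 2 := by
    intro y hy
    have hyx : ‖y‖ ≤ R / 2 + 1 := by
      have h1 := mem_ball_iff_norm.1 hy
      have h2 := norm_le_norm_add_norm_sub' y x
      linarith
    have h2 := stdGaussianDensity_pos (y - m)
    have h1 : (2 * π) ^ (-(d : ℝ) / 2) * Real.exp (-R ^ 2 / 2 - 1) ≤ stdGaussianDensity d y := by
      unfold stdGaussianDensity
      gcongr
      nlinarith [norm_nonneg y, sq_nonneg (R / 2 - 1)]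
    rw [hc]
    linarith
  have hI : c * volume.real (Metric.ball x r) ≤ (gaussMixture d m (Metric.ball x r)).toReal := by
    rw [gaussMixture_ball_toReal]
    calc c * volume.real (Metric.ball x r) = ∫ _ in Metric.ball x r, c := by
          simp [mul_comm]
      _ ≤ _ := setIntegral_mono_on (continuous_const.integrableOn_ball x r)
          ((continuous_gaussMixtureDensity m).integrableOn_ball x r)
          Metric.isOpen_ball.measurableSet hlow
  refine le_trans ?_ hI
  have hc0 : 0 ≤ c := by positivity
  refine le_trans (le_of_eq ?_)
    (mul_le_mul_of_nonneg_left (EuclideanSpace.pow_le_volume_real_ball hd x hr0.le) hc0)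
  have hpi : (2 * π) ^ (-(d : ℝ) / 2) = (1 / √(2 * π)) ^ d := by
    rw [Real.sqrt_eq_rpow, one_div, ← Real.rpow_neg (by positivity), ← Real.rpow_natCast,
      ← Real.rpow_mul (by positivity)]
    ring_nf
  have hexp : Real.exp (-R ^ 2 / 2 - 1) = Real.exp (-1) * Real.exp (-R ^ 2 / (2 * d)) ^ d := by
    rw [← Real.exp_nat_mul, ← Real.exp_add]
    congr 1
    field_simp
    ring
  rw [hc, hpi, hexp]
  have hb : Real.exp (-R ^ 2 / (2 * d)) * r / √(2 * d) =
      1 / √(2 * π) * Real.exp (-R ^ 2 / (2 * d)) * (r * √π / √(d : ℝ)) := by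
    rw [Real.sqrt_mul (by norm_num), Real.sqrt_mul (by norm_num)]
    have : 0 < √π := by positivity
    field_simp
  rw [hb, mul_pow, mul_pow]
  ring

theorem le_gaussMixture_ball_toReal_rpow (hd : 1 ≤ d) (m x : EuclideanSpace ℝ (Fin d)) {R r : ℝ}
    (hx : ‖x‖ ≤ R / 2) (hr0 : 0 < r) (hr1 : r ≤ 1) :
    (Real.exp (-1) / 2) ^ 2 * (Real.exp (-(R ^ 2 / d)) * r ^ 2 / (2 * d)) ≤
      (gaussMixture d m (Metric.ball x r)).toReal ^ (2 / (d : ℝ)) := by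
  have hd0 : (0 : ℝ) < d := by exact_mod_cast hd
  have hd1 : (1 : ℝ) ≤ d := by exact_mod_cast hd
  refine le_trans ?_ (Real.rpow_le_rpow (by positivity)
    (le_gaussMixture_ball_toReal hd m x hx hr0 hr1) (by positivity))
  rw [Real.mul_rpow (by positivity) (by positivity)]
  have h1 : (Real.exp (-1) / 2) ^ 2 ≤ (Real.exp (-1) / 2) ^ (2 / (d : ℝ)) := by
    rw [← Real.rpow_natCast (_ / 2) 2]
    refine Real.rpow_le_rpow_of_exponent_ge (by positivity) ?_ ?_
    · have : Real.exp (-1) ≤ 1 := Real.exp_le_one_iff.2 (by norm_num)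
      linarith
    · rw [div_le_iff₀ hd0]; push_cast; linarith
  have h2 : ((Real.exp (-R ^ 2 / (2 * d)) * r / √(2 * d)) ^ d) ^ (2 / (d : ℝ)) =
      Real.exp (-(R ^ 2 / d)) * r ^ 2 / (2 * d) := by
    rw [← Real.rpow_natCast, ← Real.rpow_mul (by positivity), mul_div_cancel₀ _ hd0.ne',
      Real.rpow_two, div_pow, mul_pow, Real.sq_sqrt (by positivity), ← Real.exp_nat_mul]
    congr 3
    push_cast
    field_simp
  rw [h2]
  gcongr

end GaussianDensity

/-- Proposition 4.1 with the explicit constant `L_R = 60πedR²e^{R²/d}`: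
for `‖m‖ ≤ R/2`, `‖x‖ ≤ R/2` and `0 < r ≤ 1`,
`|η̄(x,r) − η(x)| ≤ 60πedR²e^{R²/d}·μ(B(x,r))^{2/d}`. -/
theorem etaBar_sub_eta_le_of_bounded (d : ℕ) (hd : 1 ≤ d)
    (m : EuclideanSpace ℝ (Fin d)) (hm : m ≠ 0)
    (R : ℝ) (hR : 0 < R) (hmR : ‖m‖ ≤ R / 2)
    (x : EuclideanSpace ℝ (Fin d)) (hx : ‖x‖ ≤ R / 2)
    (r : ℝ) (hr0 : 0 < r) (hr1 : r ≤ 1) :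
    |gaussEtaBar d m x r - gaussEta d m x|
      ≤ 60 * π * Real.exp 1 * d * R ^ 2 * Real.exp (R ^ 2 / d) *
          ((gaussMixture d m (Metric.ball x r)).toReal) ^ (2 / (d : ℝ)) := by
  have hd0 : (0 : ℝ) < d := by exact_mod_cast hd
  have hxm : ‖x - m‖ ≤ R := (norm_sub_le x m).trans (by linarith)
  have hbias := abs_setIntegral_gaussEta_sub_le m x (r := r) (by linarith : ‖x‖ ≤ R) hxm
  have hpow := le_gaussMixture_ball_toReal_rpow hd m x hx hr0 hr1
  have hM : 0 < (gaussMixture d m (Metric.ball x r)).toReal :=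
    lt_of_lt_of_le (by positivity) (le_gaussMixture_ball_toReal hd m x hx hr0 hr1)
  have hmain : |gaussEtaBar d m x r - gaussEta d m x| ≤ R ^ 2 * r ^ 2 / 2 := by
    unfold gaussEtaBar
    rw [← mul_le_mul_iff_left₀ hM, ← abs_of_pos hM, ← abs_mul, sub_mul, mul_right_comm,
      abs_of_pos hM, inv_mul_cancel₀ hM.ne', one_mul]
    exact hbias
  refine hmain.trans (le_trans ?_ (mul_le_mul_of_nonneg_left hpow (by positivity)))
  have hexp : Real.exp (R ^ 2 / d) * Real.exp (-(R ^ 2 / d)) = 1 := by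
    rw [← Real.exp_add]; simp
  have hexp1 : Real.exp 1 * Real.exp (-1) = 1 := by
    rw [← Real.exp_add]; simp
  have hval : 60 * π * Real.exp 1 * d * R ^ 2 * Real.exp (R ^ 2 / d) *
      ((Real.exp (-1) / 2) ^ 2 * (Real.exp (-(R ^ 2 / d)) * r ^ 2 / (2 * d))) =
      (R ^ 2 * r ^ 2 / 2) * (15 * π * Real.exp (-1)) := by
    calc _ = (R ^ 2 * r ^ 2 / 2) * (15 * π * Real.exp (-1)) *
          (Real.exp (R ^ 2 / d) * Real.exp (-(R ^ 2 / d))) *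
          (Real.exp 1 * Real.exp (-1)) := by field_simp; ring
      _ = _ := by rw [hexp, hexp1, mul_one, mul_one]
  rw [hval]
  refine le_mul_of_one_le_right (by positivity) ?_
  have h1 := Real.exp_one_lt_d9
  have h2 := Real.pi_gt_three
  have h3 := Real.exp_pos (-1)
  nlinarith
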